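/- arXiv:1909.04183 — 3 statements merged into one kernel-verified Lean document; each statement's English description precedes it below -/
import Mathlib

section
/- Work in units G = 1. Let ρ₀ > 0 and R > 0, set M = (4π/3)·ρ₀·R³ and assume 2M/R < 8/9. Define for r ∈ [0,R] the interior Schwarzschild pressure p(r) = ρ₀·(√(1 − 2M r²/R³) − √(1 − 2M/R)) / (3√(1 − 2M/R) − √(1 − 2M r²/R³)). Then p(R) = 0, p(0) = ρ₀·(1 − √(1 − 2M/R))/(3√(1 − 2M/R) − 1), and for every r ∈ (0,R) the function p satisfies the Tolman–Oppenheimer–Volkoff equation with constant density: −r²·p'(r) = M(r)·ρ₀·(1 + p(r)/ρ₀)·(1 + 4π r³ p(r)/M(r))·(1 − 2M(r)/r)⁻¹, where M(r) = (4π/3)·ρ₀·r³. -/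
open Real

/-- Derivative of the interior Schwarzschild pressure profile, with `y` its surface redshift factor. -/
theorem hasDerivAt_schwarzschild_pressure (ρ k y r : ℝ) (hr : 0 < 1 - k * r ^ 2)
    (hD : 3 * y - √(1 - k * r ^ 2) ≠ 0) :
    HasDerivAt (fun s => ρ * (√(1 - k * s ^ 2) - y) / (3 * y - √(1 - k * s ^ 2)))
      (-(2 * ρ * k * r * y) / (√(1 - k * r ^ 2) * (3 * y - √(1 - k * r ^ 2)) ^ 2)) r := by
  have hsqrt : √(1 - k * r ^ 2) ≠ 0 := (Real.sqrt_pos.2 hr).ne'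
  have hpoly : HasDerivAt (fun s : ℝ => 1 - k * s ^ 2) (-(k * (2 * r))) r := by
    simpa using ((hasDerivAt_pow 2 r).const_mul k).const_sub 1
  have hroot := hpoly.sqrt hr.ne'
  refine (((hroot.sub_const y).const_mul ρ).div (hroot.const_sub (3 * y)) hD).congr_deriv ?_
  field_simp
  ring

/-- The interior Schwarzschild pressure of an incompressible star vanishes at the
surface, takes the Buchdahl value at the centre, and solves the constant-density
Tolman–Oppenheimer–Volkoff equation (units G = 1). -/
theorem interior_schwarzschild_solves_tov
    (ρ₀ R M : ℝ) (hρ₀ : 0 < ρ₀) (hR : 0 < R)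
    (hM : M = 4 * π / 3 * ρ₀ * R ^ 3)
    (hcompact : 2 * M / R < 8 / 9)
    (p : ℝ → ℝ)
    (hp : ∀ r, p r =
      ρ₀ * (Real.sqrt (1 - 2 * M * r ^ 2 / R ^ 3) - Real.sqrt (1 - 2 * M / R))
        / (3 * Real.sqrt (1 - 2 * M / R) - Real.sqrt (1 - 2 * M * r ^ 2 / R ^ 3))) :
    p R = 0 ∧
    p 0 = ρ₀ * (1 - Real.sqrt (1 - 2 * M / R))
        / (3 * Real.sqrt (1 - 2 * M / R) - 1) ∧
    ∀ r ∈ Set.Ioo 0 R,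
      -(r ^ 2) * deriv p r
        = (4 * π / 3 * ρ₀ * r ^ 3) * ρ₀ * (1 + p r / ρ₀)
          * (1 + 4 * π * r ^ 3 * p r / (4 * π / 3 * ρ₀ * r ^ 3))
          * (1 - 2 * (4 * π / 3 * ρ₀ * r ^ 3) / r)⁻¹ := by
  have hk : 0 < 8 * π / 3 * ρ₀ := by positivity
  obtain ⟨k, hk_def⟩ : ∃ k, k = 8 * π / 3 * ρ₀ := ⟨_, rfl⟩
  rw [← hk_def] at hk
  have hsurface : 2 * M / R = k * R ^ 2 := by
    rw [hM, hk_def]; field_simp; ring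
  have hinner (r : ℝ) : 2 * M * r ^ 2 / R ^ 3 = k * r ^ 2 := by
    rw [hM, hk_def]; field_simp; ring
  simp only [hsurface, hinner] at hp hcompact ⊢
  refine ⟨by simp [hp], by simp [hp], fun r ⟨hr, hrR⟩ => ?_⟩
  have hy : 1 / 3 < √(1 - k * R ^ 2) := Real.lt_sqrt_of_sq_lt (by linarith)
  have hkr : k * r ^ 2 < k * R ^ 2 := by gcongr
  have hpos : 0 < 1 - k * r ^ 2 := by linarith
  have hx : 0 < √(1 - k * r ^ 2) := Real.sqrt_pos.2 hpos
  have hx1 : √(1 - k * r ^ 2) ≤ 1 := Real.sqrt_le_one.2 (by nlinarith [sq_nonneg r])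
  have hD : 0 < 3 * √(1 - k * R ^ 2) - √(1 - k * r ^ 2) := by linarith
  have hmass : 4 * π / 3 * ρ₀ * r ^ 3 = k * r ^ 3 / 2 := by rw [hk_def]; ring
  have hmetric : 1 - 2 * (4 * π / 3 * ρ₀ * r ^ 3) / r = √(1 - k * r ^ 2) ^ 2 := by
    rw [Real.sq_sqrt hpos.le, hmass]; field_simp
  have hratio : 4 * π * r ^ 3 * p r / (4 * π / 3 * ρ₀ * r ^ 3) = 3 * (p r / ρ₀) := by
    field_simp
  have hderiv := hasDerivAt_schwarzschild_pressure ρ₀ k _ r hpos hD.ne'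
  rw [← funext hp] at hderiv
  rw [hmetric, hratio, hmass, hderiv.deriv, hp]
  generalize √(1 - k * r ^ 2) = x at hx hD ⊢
  generalize √(1 - k * R ^ 2) = y at hD ⊢
  have henthalpy : 1 + ρ₀ * (x - y) / (3 * y - x) / ρ₀ = 2 * y / (3 * y - x) := by
    rw [div_right_comm, mul_div_cancel_left₀ _ hρ₀.ne', one_add_div hD.ne']
    ring
  have hactive : 1 + 3 * (ρ₀ * (x - y) / (3 * y - x) / ρ₀) = 2 * x / (3 * y - x) := by
    linear_combination 3 * henthalpy + 2 * div_self hD.ne'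
  rw [henthalpy, hactive]
  field_simp
end

section
/- Let ρ₀ > 0. The central pressure of an incompressible star of compactness x = GM/R, given by p_c(x) = ρ₀·(1 − √(1 − 2x)) / (3√(1 − 2x) − 1) for x ∈ (0, 4/9), tends to +∞ as x tends to 4/9 from the left. Hence an infinite central pressure is required to hold the star in equilibrium at GM/R = 4/9, and all static stars must satisfy GM/R < 4/9 (Buchdahl's bound). -/
open Real Filter

/-- Buchdahl's bound: the central pressure of an incompressible star,
`p_c(x) = ρ₀(1 − √(1−2x))/(3√(1−2x) − 1)` with compactness `x = GM/R ∈ (0, 4/9)`,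
tends to `+∞` as `x → 4/9⁻`. -/
theorem buchdahl_central_pressure_blowup (ρ₀ : ℝ) (hρ₀ : 0 < ρ₀) :
    Tendsto
      (fun x : ℝ =>
        ρ₀ * (1 - Real.sqrt (1 - 2 * x)) / (3 * Real.sqrt (1 - 2 * x) - 1))
      (nhdsWithin (4 / 9) (Set.Ioo 0 (4 / 9))) atTop := by
  have h_limit : Real.sqrt (1 - 2 * (4 / 9)) = 1 / 3 := by
    rw [show (1 - 2 * (4 / 9) : ℝ) = (1 / 3) ^ 2 by norm_num]
    exact Real.sqrt_sq (by norm_num)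
  have h_num : Tendsto (fun x : ℝ => ρ₀ * (1 - Real.sqrt (1 - 2 * x)))
      (nhdsWithin (4 / 9) (Set.Ioo 0 (4 / 9))) (nhds (ρ₀ * (1 - 1 / 3))) := by
    rw [← h_limit]
    exact (Continuous.tendsto (by fun_prop) (4 / 9 : ℝ)).mono_left nhdsWithin_le_nhds
  have h_den : Tendsto (fun x : ℝ => 3 * Real.sqrt (1 - 2 * x) - 1)
      (nhdsWithin (4 / 9) (Set.Ioo 0 (4 / 9))) (nhdsWithin 0 (Set.Ioi 0)) := by
    refine tendsto_nhdsWithin_iff.mpr ⟨?_, ?_⟩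
    · rw [show (0 : ℝ) = 3 * Real.sqrt (1 - 2 * (4 / 9)) - 1 by rw [h_limit]; norm_num]
      exact (Continuous.tendsto (by fun_prop : Continuous fun x : ℝ =>
        3 * Real.sqrt (1 - 2 * x) - 1) (4 / 9 : ℝ)).mono_left nhdsWithin_le_nhds
    · filter_upwards [self_mem_nhdsWithin] with x hx
      have h_sqrt : 1 / 3 < Real.sqrt (1 - 2 * x) := by
        rw [← h_limit]
        exact Real.sqrt_lt_sqrt (by norm_num) (by linarith [hx.2])
      rw [Set.mem_Ioi]
      linarith
  simp only [div_eq_mul_inv (ρ₀ * _)]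
  exact h_num.pos_mul_atTop (by linarith) (tendsto_inv_nhdsGT_zero.comp h_den)
end

section
/- Let α > 0. Then the integral ∫₀^∞ e^{−2αu − (2/3)u³} · ( ∫₀^u e^{2αv + (2/3)v³} dv ) du is finite. Hence the Feller explosion functional for the SDE du = (α + u²)dt + dB, namely ∫₀^∞ Λ(−u)·( ∫₀^u Λ(+v) dv ) du with Λ(±x) = exp(±(2αx + (2/3)x³)), is finite, so by Feller's test this SDE with additive noise explodes in finite time. -/
open Real MeasureTheory

/-- The Feller scale exponent `2αx + (2/3)x³` satisfies a one-sided slope bound on `[0, u]`. -/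
lemma feller_exponent_le (α u v : ℝ) (hv : 0 ≤ v) (hvu : v ≤ u) :
    2 * α * v + 2 / 3 * v ^ 3 ≤
      2 * α * u + 2 / 3 * u ^ 3 + (2 * α + 2 / 3 * u ^ 2) * (v - u) := by
  have h : 0 ≤ (u - v) * (v * (u + v)) :=
    mul_nonneg (by linarith) (mul_nonneg hv (by linarith))
  nlinarith

/-- An exponential with rate `c > 0` that equals `exp a` at `u` has integral at most `exp a / c`
over `[0, u]`. -/
lemma integral_exp_add_mul_sub_le (a c u : ℝ) (hc : 0 < c) :
    ∫ v in (0 : ℝ)..u, Real.exp (a + c * (v - u)) ≤ Real.exp a / c := by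
  have hderiv : ∀ v ∈ Set.uIcc 0 u,
      HasDerivAt (fun v => Real.exp (a + c * (v - u)) / c) (Real.exp (a + c * (v - u))) v := by
    intro v _
    have h := (((((hasDerivAt_id v).sub_const u).const_mul c).const_add a).exp).div_const c
    simpa [hc.ne'] using h
  rw [intervalIntegral.integral_eq_sub_of_hasDerivAt hderiv
    (Continuous.intervalIntegrable (by fun_prop) _ _)]
  have : 0 ≤ Real.exp (a + c * (0 - u)) / c := by positivity
  simpa using this

/-- The integrand of the Feller functional is dominated by `(2α + (2/3)u²)⁻¹`. -/
lemma feller_integrand_le (α u : ℝ) (hα : 0 < α) (hu : 0 ≤ u) :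
    Real.exp (-(2 * α * u + 2 / 3 * u ^ 3)) *
        ∫ v in (0:ℝ)..u, Real.exp (2 * α * v + 2 / 3 * v ^ 3) ≤
      (2 * α + 2 / 3 * u ^ 2)⁻¹ := by
  have hle : ∫ v in (0:ℝ)..u, Real.exp (2 * α * v + 2 / 3 * v ^ 3) ≤
      Real.exp (2 * α * u + 2 / 3 * u ^ 3) / (2 * α + 2 / 3 * u ^ 2) := by
    refine le_trans (intervalIntegral.integral_mono_on hu
      (Continuous.intervalIntegrable (by fun_prop) _ _)
      (Continuous.intervalIntegrable (by fun_prop) _ _) fun v hv =>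
        Real.exp_le_exp.2 (feller_exponent_le α u v hv.1 hv.2))
      (integral_exp_add_mul_sub_le _ _ u (by positivity))
  refine (mul_le_mul_of_nonneg_left hle (Real.exp_pos _).le).trans_eq ?_
  rw [Real.exp_neg]
  field_simp

/-- The Feller explosion functional of the SDE `du = (α + u²)dt + dB`, namely
`∫₀^∞ Λ(−u) (∫₀^u Λ(+v) dv) du` with `Λ(±x) = exp(±(2αx + (2/3)x³))`, is finite;
hence by Feller's test this SDE explodes in finite time. -/
theorem feller_riccati_additive_noise_explosion (α : ℝ) (hα : 0 < α) :
    IntegrableOn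
      (fun u => Real.exp (-(2 * α * u + 2 / 3 * u ^ 3)) *
        ∫ v in (0:ℝ)..u, Real.exp (2 * α * v + 2 / 3 * v ^ 3))
      (Set.Ioi (0:ℝ)) := by
  have hcont : Continuous fun u => Real.exp (-(2 * α * u + 2 / 3 * u ^ 3)) *
      ∫ v in (0:ℝ)..u, Real.exp (2 * α * v + 2 / 3 * v ^ 3) := by
    refine Continuous.mul (by fun_prop) (intervalIntegral.continuous_primitive
      (fun a b => Continuous.intervalIntegrable (by fun_prop) a b) 0)
  refine Integrable.mono'
    ((integrable_inv_one_add_sq.const_mul ((2 * α)⁻¹ + 3 / 2)).integrableOn)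
    hcont.aestronglyMeasurable ?_
  refine (ae_restrict_mem measurableSet_Ioi).mono fun u hu => ?_
  have hu0 : 0 ≤ u := le_of_lt hu
  rw [Real.norm_of_nonneg (mul_nonneg (Real.exp_pos _).le
    (intervalIntegral.integral_nonneg hu0 fun v _ => (Real.exp_pos _).le))]
  refine (feller_integrand_le α u hα hu0).trans ?_
  rw [← div_eq_mul_inv, inv_eq_one_div, div_le_div_iff₀ (by positivity) (by positivity)]
  have h : ((2 * α)⁻¹ + 3 / 2) * (2 * α + 2 / 3 * u ^ 2) =
      1 * (1 + u ^ 2) + (3 * α + u ^ 2 / (3 * α)) := by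
    field_simp
    ring
  rw [h]
  exact le_add_of_nonneg_right (by positivity)
end
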